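/- Gaussian location model higher-order accuracy: let y_t = β + u_t for t = 1,...,T, where {u_t} is a mean-zero covariance-stationary Gaussian process with Σ_{h=1}^∞ h²|γ(h)| < ∞ and positive long-run variance. Under H₀: β = 0, with β̂_k = G⁻¹Σ_{t∈H_k} y_t (K equal blocks of length G = T/K), β̄ = K⁻¹Σβ̂_k, and T_K = √K β̄ / √((K−1)⁻¹Σ(β̂_k − β̄)²), one has |P(|T_K| > t_{K−1}(1−α/2)) − α| = O(T⁻¹), where t_{K−1}(1−α/2) is the (1−α/2)-quantile of the t-distribution with K−1 degrees of freedom. -/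

import Mathlib

open MeasureTheory ProbabilityTheory Finset
open scoped ENNReal NNReal

/-- The Student t-distribution with `ν` degrees of freedom, as a measure on ℝ
given by its Lebesgue density. -/
noncomputable def studentTMeasure (ν : ℝ) : Measure ℝ :=
  volume.withDensity fun x => ENNReal.ofReal
    (Real.Gamma ((ν + 1) / 2) / (Real.sqrt (ν * Real.pi) * Real.Gamma (ν / 2)) *
      (1 + x ^ 2 / ν) ^ (-((ν + 1) / 2)))

/-- Mean of the `k`-th block (`k = 0, …, K−1`) of length `G`:
`β̂_k = G⁻¹ Σ_{t=kG+1}^{(k+1)G} u_t`. -/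
noncomputable def blockMean {Ω : Type*} (u : ℕ → Ω → ℝ) (G k : ℕ) (ω : Ω) : ℝ :=
  (G : ℝ)⁻¹ * ∑ t ∈ Finset.Ioc (k * G) ((k + 1) * G), u t ω

/-- The self-normalized t-statistic `√K v̄ / √((K−1)⁻¹ Σ (v_k − v̄)²)`. -/
noncomputable def selfNormT (K : ℕ) (v : ℕ → ℝ) : ℝ :=
  Real.sqrt K * ((K : ℝ)⁻¹ * ∑ k ∈ Finset.range K, v k) /
    Real.sqrt (((K : ℝ) - 1)⁻¹ *
      ∑ k ∈ Finset.range K, (v k - (K : ℝ)⁻¹ * ∑ j ∈ Finset.range K, v j) ^ 2)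

section partA
variable {V : Type*} [NormedAddCommGroup V] [InnerProductSpace ℝ V] [FiniteDimensional ℝ V]
  [MeasurableSpace V] [BorelSpace V]

lemma stdGaussian_density :
    stdGaussian V = volume.withDensity (fun x : V => ENNReal.ofReal
      (((2 * Real.pi) ^ (Module.finrank ℝ V / 2 : ℝ))⁻¹ * Real.exp (-‖x‖ ^ 2 / 2))) := by
  have hpos : (0:ℝ) < (2 * Real.pi) ^ (Module.finrank ℝ V / 2 : ℝ) := by positivity
  have hint : Integrable (fun x : V => ((2 * Real.pi) ^ (Module.finrank ℝ V / 2 : ℝ))⁻¹ * Real.exp (-‖x‖ ^ 2 / 2)) := by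
    apply Integrable.const_mul
    have h := (GaussianFourier.integrable_cexp_neg_mul_sq_norm_add (V := V) (b := 1/2)
      (by norm_num) 0 0).re
    refine h.congr (ae_of_all _ fun x => ?_)
    simp only [zero_mul, add_zero]
    have : (-(1/2) * (‖x‖:ℂ)^2) = ((-‖x‖^2/2 : ℝ) : ℂ) := by push_cast; ring
    rw [this, ← Complex.ofReal_exp]
    exact Complex.ofReal_re _
  have hfin : IsFiniteMeasure (volume.withDensity (fun x : V => ENNReal.ofReal
      (((2 * Real.pi) ^ (Module.finrank ℝ V / 2 : ℝ))⁻¹ * Real.exp (-‖x‖ ^ 2 / 2)))) :=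
    isFiniteMeasure_withDensity_ofReal hint.2
  apply Measure.ext_of_charFun
  ext t
  rw [charFun_stdGaussian, charFun_apply]
  rw [integral_withDensity_eq_integral_toReal_smul (by fun_prop) (by simp)]
  have h := GaussianFourier.integral_cexp_neg_mul_sq_norm_add (V := V) (b := 1/2)
      (by norm_num) Complex.I t
  have e1 : ∀ x : V, (ENNReal.ofReal (((2 * Real.pi) ^ (Module.finrank ℝ V / 2 : ℝ))⁻¹ * Real.exp (-‖x‖ ^ 2 / 2))).toReal • Complex.exp (inner ℝ x t * Complex.I)
    = (((2 * Real.pi) ^ (Module.finrank ℝ V / 2 : ℝ))⁻¹ : ℝ) * Complex.exp (-(1/2) * ‖x‖^2 + Complex.I * inner ℝ t x) := by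
    intro x
    rw [ENNReal.toReal_ofReal (by positivity), Complex.exp_add, real_inner_comm]
    have : (-(1/2) * (‖x‖:ℂ)^2) = ((-‖x‖^2/2 : ℝ) : ℂ) := by push_cast; ring
    rw [this, ← Complex.ofReal_exp, Complex.real_smul]
    push_cast
    rw [mul_comm Complex.I]; ring
  simp_rw [e1]
  rw [integral_const_mul, h]
  have e2 : ((Real.pi : ℂ) / (1/2)) ^ (Module.finrank ℝ V / 2 : ℂ) = (((2 * Real.pi) ^ (Module.finrank ℝ V / 2 : ℝ) : ℝ) : ℂ) := by
    rw [Complex.ofReal_cpow (by positivity)]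
    push_cast
    congr 1; ring
  rw [e2, ← mul_assoc, ← Complex.ofReal_mul, inv_mul_cancel₀ hpos.ne']
  simp
  congr 1
  ring

lemma lintegral_lin (L : V →ₗ[ℝ] V) (hL : LinearMap.det L ≠ 0) (E : Set V) (hE : MeasurableSet E)
    (f : V → ℝ≥0∞) (hf : Measurable f) :
    ∫⁻ y in L ⁻¹' E, f (L y) = ENNReal.ofReal |(LinearMap.det L)⁻¹| * ∫⁻ x in E, f x := by
  have hLm : Measurable L := (LinearMap.continuous_of_finiteDimensional L).measurable
  have h := Measure.map_linearMap_addHaar_eq_smul_addHaar (volume : Measure V) hL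
  rw [← setLIntegral_map hE hf hLm, h, Measure.restrict_smul, lintegral_smul_measure, smul_eq_mul]

lemma lintegral_scale (E : Set V) (hE : MeasurableSet E) (hs : ∀ c : ℝ, 0 < c → ∀ x, c • x ∈ E ↔ x ∈ E)
    (s : ℝ) (hs0 : 0 < s) (k : ℝ≥0∞):
    ∫⁻ x in E, k * ENNReal.ofReal (Real.exp (-‖x‖ ^ 2 / (2 * s))) =
      ENNReal.ofReal (√s ^ Module.finrank ℝ V) *
        ∫⁻ x in E, k * ENNReal.ofReal (Real.exp (-‖x‖ ^ 2 / 2)) := by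
  have hq : 0 < √s := Real.sqrt_pos.2 hs0
  have hd : LinearMap.det ((√s)⁻¹ • (LinearMap.id : V →ₗ[ℝ] V)) = ((√s)⁻¹) ^ Module.finrank ℝ V := by
    rw [LinearMap.det_smul]; simp
  have h := lintegral_lin ((√s)⁻¹ • (LinearMap.id : V →ₗ[ℝ] V)) (by rw [hd]; positivity) E hE
    (fun x => k * ENNReal.ofReal (Real.exp (-‖x‖ ^ 2 / 2))) (by fun_prop)
  rw [hd] at h
  have e : ((√s)⁻¹ • (LinearMap.id : V →ₗ[ℝ] V)) ⁻¹' E = E := by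
    ext x
    simpa using hs (√s)⁻¹ (by positivity) x
  rw [e] at h
  rw [inv_pow, inv_inv, abs_of_pos (by positivity)] at h
  rw [← h]
  congr 1
  ext x
  congr 3
  simp only [LinearMap.smul_apply, LinearMap.id_apply, norm_smul, norm_inv, Real.norm_eq_abs, abs_of_pos hq]
  rw [mul_pow, inv_pow, Real.sq_sqrt hs0.le]
  field_simp

lemma gauss_dom (L : V →ₗ[ℝ] V) (m M : ℝ) (hm : 0 < m) (hM : 0 < M)
    (hlo : ∀ y, m * ‖y‖ ^ 2 ≤ ‖L y‖ ^ 2) (hhi : ∀ y, ‖L y‖ ^ 2 ≤ M * ‖y‖ ^ 2)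
    (E : Set V) (hE : MeasurableSet E) (hs : ∀ c : ℝ, 0 < c → ∀ x, c • x ∈ E ↔ x ∈ E) :
    (stdGaussian V).map L E ≤ ENNReal.ofReal ((√M / √m) ^ Module.finrank ℝ V) * stdGaussian V E := by
  have hLm : Measurable L := (LinearMap.continuous_of_finiteDimensional L).measurable
  have hinj : Function.Injective L := by
    rw [← LinearMap.ker_eq_bot, LinearMap.ker_eq_bot']
    intro y hy
    have := hlo y
    rw [hy] at this
    have h2 : ‖y‖^2 ≤ 0 := by
      simp at this
      by_contra hc
      push Not at hc
      nlinarith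
    have h3 : ‖y‖ = 0 := by nlinarith [sq_nonneg ‖y‖, norm_nonneg y]
    simpa using h3
  have hdet : LinearMap.det L ≠ 0 := by
    have := (LinearMap.isUnit_iff_ker_eq_bot L).2 (LinearMap.ker_eq_bot.2 hinj)
    exact (LinearMap.isUnit_det L this).ne_zero
  set k := ENNReal.ofReal ((2 * Real.pi) ^ (Module.finrank ℝ V / 2 : ℝ))⁻¹ with hk
  set D := ENNReal.ofReal |(LinearMap.det L)⁻¹| with hD
  have dens : ∀ F : Set V, MeasurableSet F → stdGaussian V F = ∫⁻ x in F, k * ENNReal.ofReal (Real.exp (-‖x‖ ^ 2 / 2)) := by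
    intro F hF
    rw [stdGaussian_density, withDensity_apply _ hF]
    congr 1; ext x
    rw [ENNReal.ofReal_mul (by positivity)]
  have h1 : (stdGaussian V).map L E ≤ D * (ENNReal.ofReal (√M ^ Module.finrank ℝ V) * stdGaussian V E) := by
    rw [Measure.map_apply hLm hE, dens _ (hLm hE), dens _ hE, ← lintegral_scale E hE hs M hM k,
      ← lintegral_lin L hdet E hE _ (by fun_prop)]
    apply lintegral_mono
    intro y
    dsimp only
    refine mul_le_mul_right (ENNReal.ofReal_le_ofReal (Real.exp_le_exp.2 ?_)) _
    have := hhi y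
    rw [div_le_div_iff₀ (by norm_num) (by positivity)]
    nlinarith
  have h2 : D * (ENNReal.ofReal (√m ^ Module.finrank ℝ V)) ≤ 1 := by
    have e : stdGaussian V Set.univ = 1 := measure_univ
    have e' := e
    rw [dens _ .univ] at e'
    rw [← mul_one (D * _), mul_assoc, ← e', ← lintegral_scale Set.univ .univ (by simp) m hm k,
      ← lintegral_lin L hdet Set.univ .univ _ (by fun_prop), Set.preimage_univ]
    apply lintegral_mono
    intro y
    dsimp only
    refine mul_le_mul_right (ENNReal.ofReal_le_ofReal (Real.exp_le_exp.2 ?_)) _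
    have := hlo y
    rw [div_le_div_iff₀ (by positivity) (by norm_num)]
    nlinarith
  have hp : 0 < √m ^ Module.finrank ℝ V := by have := Real.sqrt_pos.2 hm; positivity
  refine h1.trans ?_
  rw [← mul_assoc]
  gcongr
  rw [div_pow, ENNReal.ofReal_div_of_pos hp]
  rw [ENNReal.le_div_iff_mul_le (by left; exact (ENNReal.ofReal_pos.2 hp).ne') (by left; simp)]
  calc _ = (D * ENNReal.ofReal (√m ^ Module.finrank ℝ V)) * ENNReal.ofReal (√M ^ Module.finrank ℝ V) := by ring
    _ ≤ 1 * ENNReal.ofReal (√M ^ Module.finrank ℝ V) := by gcongr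
    _ = _ := one_mul _
end partA
section partC

lemma real_radial (n : ℕ) (hn : 1 ≤ n) (b : ℝ) (hb : 0 < b) :
    Integrable (fun w : EuclideanSpace ℝ (Fin n) => ‖w‖ * Real.exp (-b * ‖w‖ ^ 2)) ∧
    ∫ w : EuclideanSpace ℝ (Fin n), ‖w‖ * Real.exp (-b * ‖w‖ ^ 2) =
      √Real.pi ^ n * Real.Gamma (((n : ℝ) + 1) / 2) / Real.Gamma ((n : ℝ) / 2) * b ^ (-(((n : ℝ) + 1) / 2)) := by
  have : Nonempty (Fin n) := ⟨⟨0, hn⟩⟩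
  have : Nontrivial (EuclideanSpace ℝ (Fin n)) := inferInstance
  have e : ∀ y ∈ Set.Ioi (0:ℝ), y ^ (n - 1) • (y * Real.exp (-b * y ^ 2)) = y ^ (n : ℝ) * Real.exp (-b * y ^ (2:ℝ)) := by
    intro y hy
    rw [Real.rpow_natCast, Real.rpow_two, smul_eq_mul, ← mul_assoc, ← pow_succ, Nat.sub_add_cancel hn]
  have hG : 0 < Real.Gamma ((n : ℝ) / 2) := Real.Gamma_pos_of_pos (by positivity)
  constructor
  · have h := integrable_fun_norm_addHaar (volume : Measure (EuclideanSpace ℝ (Fin n)))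
      (f := fun y : ℝ => y * Real.exp (-b * y ^ 2))
    refine h.2 ?_
    rw [finrank_euclideanSpace, Fintype.card_fin, integrableOn_congr_fun e measurableSet_Ioi]
    have := integrableOn_rpow_mul_exp_neg_mul_rpow (s := n) (p := 2) (b := b) (by linarith [Nat.cast_nonneg (α := ℝ) n]) (by norm_num) hb
    exact this
  · have h := integral_fun_norm_addHaar (volume : Measure (EuclideanSpace ℝ (Fin n)))
      (fun y : ℝ => y * Real.exp (-b * y ^ 2))
    rw [h, finrank_euclideanSpace, Fintype.card_fin, setIntegral_congr_fun measurableSet_Ioi e,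
      integral_rpow_mul_exp_neg_mul_rpow (by norm_num) (by linarith [Nat.cast_nonneg (α := ℝ) n]) hb,
      Measure.real, EuclideanSpace.volume_ball]
    have hn0 : ((n:ℝ)/2) ≠ 0 := by positivity
    rw [Fintype.card_fin, Real.Gamma_add_one hn0]
    simp only [ENNReal.ofReal_one, one_pow, one_mul]
    rw [ENNReal.toReal_ofReal (by positivity), nsmul_eq_mul, smul_eq_mul, neg_div]
    field_simp

lemma inner_lintegral (n : ℕ) (hn : 1 ≤ n) (x : ℝ) :
    ∫⁻ w : EuclideanSpace ℝ (Fin n), ENNReal.ofReal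
        ((√(2 * Real.pi))⁻¹ * (‖w‖ / √n) * Real.exp (-(x ^ 2 * (‖w‖ / √n) ^ 2) / 2)) ∂(stdGaussian _) =
      ENNReal.ofReal
    (Real.Gamma (((n:ℝ) + 1) / 2) / (Real.sqrt ((n:ℝ) * Real.pi) * Real.Gamma ((n:ℝ) / 2)) *
      (1 + x ^ 2 / n) ^ (-(((n:ℝ) + 1) / 2))) := by
  have hn' : (0:ℝ) < n := by exact_mod_cast hn
  have hp := Real.pi_pos
  set b : ℝ := (1 + x ^ 2 / n) / 2 with hb
  have hb0 : 0 < b := by positivity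
  obtain ⟨hi, hv⟩ := real_radial n hn b hb0
  rw [stdGaussian_density, lintegral_withDensity_eq_lintegral_mul _ (by fun_prop) (by fun_prop)]
  rw [finrank_euclideanSpace, Fintype.card_fin]
  set c : ℝ := ((2 * Real.pi) ^ (n / 2 : ℝ))⁻¹ * (√(2 * Real.pi))⁻¹ * (√n)⁻¹ with hc
  have hc0 : 0 ≤ c := by positivity
  have e : ∀ w : EuclideanSpace ℝ (Fin n), ((fun x : EuclideanSpace ℝ (Fin n) => ENNReal.ofReal (((2 * Real.pi) ^ (n / 2 : ℝ))⁻¹ * Real.exp (-‖x‖ ^ 2 / 2))) * (fun w : EuclideanSpace ℝ (Fin n) => ENNReal.ofReal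
        ((√(2 * Real.pi))⁻¹ * (‖w‖ / √n) * Real.exp (-(x ^ 2 * (‖w‖ / √n) ^ 2) / 2)))) w
      = ENNReal.ofReal (c * (‖w‖ * Real.exp (-b * ‖w‖ ^ 2))) := by
    intro w
    rw [Pi.mul_apply, ← ENNReal.ofReal_mul (by positivity)]
    congr 1
    have : Real.exp (-b * ‖w‖ ^ 2) = Real.exp (-‖w‖ ^ 2 / 2) * Real.exp (-(x ^ 2 * (‖w‖ / √n) ^ 2) / 2) := by
      rw [← Real.exp_add, div_pow, Real.sq_sqrt hn'.le, hb]
      congr 1; field_simp; ring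
    rw [this, hc]; field_simp
  simp_rw [e]
  rw [← ofReal_integral_eq_lintegral_ofReal (hi.const_mul c) (ae_of_all _ fun w => by positivity),
    integral_const_mul, hv]
  congr 1
  have h1 : b ^ (-(((n : ℝ) + 1) / 2)) = (1 + x ^ 2 / n) ^ (-(((n : ℝ) + 1) / 2)) * 2 ^ (((n : ℝ) + 1) / 2) := by
    rw [hb, Real.div_rpow (by positivity) (by norm_num), Real.rpow_neg (by norm_num : (0:ℝ) ≤ 2)]
    simp
  have h2 : (2:ℝ) ^ (((n : ℝ) + 1) / 2) = √2 ^ n * √2 := by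
    rw [← pow_succ, ← Real.rpow_natCast, Real.sqrt_eq_rpow, ← Real.rpow_mul (by norm_num)]
    congr 1; push_cast; ring
  have h3 : (2 * Real.pi) ^ (n / 2 : ℝ) = √2 ^ n * √Real.pi ^ n := by
    rw [← mul_pow, ← Real.sqrt_mul (by norm_num), ← Real.rpow_natCast, Real.sqrt_eq_rpow, ← Real.rpow_mul (by positivity)]
    congr 1; ring
  have hG : 0 < Real.Gamma ((n : ℝ) / 2) := Real.Gamma_pos_of_pos (by positivity)
  rw [h1, h2, hc, h3, Real.sqrt_mul (by norm_num), Real.sqrt_mul hn'.le]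
  field_simp

lemma student_prod (n : ℕ) (hn : 1 ≤ n) (E : Set ℝ) (hE : MeasurableSet E) :
    ((gaussianReal 0 1).prod (stdGaussian (EuclideanSpace ℝ (Fin n)))) {p | p.1 / (‖p.2‖ / √n) ∈ E}
      = studentTMeasure n E := by
  have hn' : (0:ℝ) < n := by exact_mod_cast hn
  have : Nonempty (Fin n) := ⟨⟨0, hn⟩⟩
  have hm : MeasurableSet {p : ℝ × EuclideanSpace ℝ (Fin n) | p.1 / (‖p.2‖ / √n) ∈ E} :=
    (by fun_prop : Measurable (fun p : ℝ × EuclideanSpace ℝ (Fin n) => p.1 / (‖p.2‖ / √n))) hE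
  rw [Measure.prod_apply_symm hm]
  have hne : ∀ᵐ w ∂(stdGaussian (EuclideanSpace ℝ (Fin n))), w ≠ 0 := by
    rw [stdGaussian_density]
    refine (withDensity_absolutelyContinuous _ _).ae_le ?_
    exact (measure_eq_zero_iff_ae_notMem (s := {0})).1 (measure_singleton _)
  have e : ∀ᵐ w ∂(stdGaussian (EuclideanSpace ℝ (Fin n))),
      gaussianReal 0 1 ((fun x => (x, w)) ⁻¹' {p | p.1 / (‖p.2‖ / √n) ∈ E}) =
      ∫⁻ x in E, ENNReal.ofReal
        ((√(2 * Real.pi))⁻¹ * (‖w‖ / √n) * Real.exp (-(x ^ 2 * (‖w‖ / √n) ^ 2) / 2)) := by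
    filter_upwards [hne] with w hw
    have hr : 0 < ‖w‖ / √n := by have := norm_pos_iff.2 hw; positivity
    set r := ‖w‖ / √n
    have : ((fun x => (x, w)) ⁻¹' {p : ℝ × EuclideanSpace ℝ (Fin n) | p.1 / (‖p.2‖ / √n) ∈ E}) = (fun x => x / r) ⁻¹' E := rfl
    rw [this, ← Measure.map_apply (by fun_prop) hE, gaussianReal_map_div_const, gaussianReal_apply]
    · congr 1; ext x
      rw [gaussianPDF, gaussianPDFReal]
      congr 1
      simp
      rw [Real.sqrt_mul (by positivity), Real.sqrt_inv, Real.sqrt_sq hr.le]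
      have e2 : -x ^ 2 / (2 * (r ^ 2)⁻¹) = -(x ^ 2 * r ^ 2) / 2 := by field_simp
      rw [e2, Real.sqrt_mul (by norm_num)]
      field_simp
    · rw [← NNReal.coe_ne_zero]; simp [hr.ne']
  rw [lintegral_congr_ae e, lintegral_lintegral_swap (by fun_prop)]
  simp_rw [inner_lintegral n hn]
  rw [studentTMeasure, withDensity_apply _ hE]
end partC
section partD
noncomputable def tst (K : ℕ) (x : EuclideanSpace ℝ (Fin K)) : ℝ :=
  Real.sqrt K * ((K : ℝ)⁻¹ * ∑ k, x k) /
    Real.sqrt (((K : ℝ) - 1)⁻¹ *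
      ∑ k, (x k - (K : ℝ)⁻¹ * ∑ j, x j) ^ 2)

lemma tst_measurable (K : ℕ) : Measurable (tst K) := by unfold tst; fun_prop

lemma tst_scale (K : ℕ) (c : ℝ) (hc : 0 < c) (x : EuclideanSpace ℝ (Fin K)) :
    tst K (c • x) = tst K x := by
  unfold tst
  simp only [PiLp.smul_apply, smul_eq_mul, ← mul_sum]
  have : ∀ k, (c * x k - (K:ℝ)⁻¹ * (c * ∑ j, x j)) ^ 2 = c ^ 2 * (x k - (K:ℝ)⁻¹ * ∑ j, x j) ^ 2 := by
    intro k; ring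
  simp_rw [this, ← mul_sum]
  rw [show ∀ a b : ℝ, a * (c ^ 2 * b) = c ^ 2 * (a * b) by intros; ring, Real.sqrt_mul (by positivity),
    Real.sqrt_sq hc.le, show ∀ a b d: ℝ, a * (b * (c * d)) = c * (a * (b * d)) by intros; ring]
  rw [mul_div_mul_left _ _ hc.ne']

lemma tst_repr (n : ℕ) : ∃ f : EuclideanSpace ℝ (Fin (n + 1)) ≃ₗᵢ[ℝ] EuclideanSpace ℝ (Fin (n + 1)),
    ∀ x, tst (n + 1) x = f x 0 / √((n : ℝ)⁻¹ * ∑ i : Fin n, f x i.succ ^ 2) := by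
  set e : EuclideanSpace ℝ (Fin (n + 1)) := WithLp.toLp 2 (fun _ => (√((n + 1 : ℕ) : ℝ))⁻¹) with he
  have hK : (0:ℝ) < ((n + 1 : ℕ) : ℝ) := by positivity
  have hne : ‖e‖ = 1 := by
    rw [EuclideanSpace.norm_eq]
    simp only [he, Real.norm_eq_abs, sq_abs, inv_pow, Real.sq_sqrt hK.le]
    simp
    rw [mul_inv_cancel₀ (by positivity)]
  have hon : Orthonormal ℝ (({0} : Set (Fin (n + 1))).domRestrict (fun _ => e)) := by
    constructor
    · intro i; exact hne
    · intro i j hij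
      exact absurd (Subsingleton.elim i j) hij
  obtain ⟨b, hb⟩ := hon.exists_orthonormalBasis_extension_of_card_eq (by simp)
  have hb0 : b 0 = e := hb 0 rfl
  refine ⟨b.repr, fun x => ?_⟩
  have h0 : b.repr x 0 = (√((n + 1 : ℕ) : ℝ))⁻¹ * ∑ k, x k := by
    rw [b.repr_apply_apply, hb0, PiLp.inner_apply, mul_sum]
    simp [he, mul_comm]
  have hnorm : ‖b.repr x‖ ^ 2 = ‖x‖ ^ 2 := by rw [LinearIsometryEquiv.norm_map]
  rw [EuclideanSpace.real_norm_sq_eq, EuclideanSpace.real_norm_sq_eq, Fin.sum_univ_succ] at hnorm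
  have h1 : ∑ i : Fin n, b.repr x i.succ ^ 2 = ∑ k, (x k - ((n+1:ℕ) : ℝ)⁻¹ * ∑ j, x j) ^ 2 := by
    have : ∀ k, (x k - ((n+1:ℕ) : ℝ)⁻¹ * ∑ j, x j) ^ 2 = x k ^ 2 - 2 * (((n+1:ℕ) : ℝ)⁻¹ * ∑ j, x j) * x k
      + (((n+1:ℕ) : ℝ)⁻¹ * ∑ j, x j) ^ 2 := by intro k; ring
    simp_rw [this]
    rw [sum_add_distrib, sum_sub_distrib, ← mul_sum, sum_const, card_univ, Fintype.card_fin, ← hnorm, h0,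
      mul_pow, inv_pow, Real.sq_sqrt hK.le, nsmul_eq_mul]
    field_simp
    ring
  rw [h1, h0, tst]
  have h2 : ((n+1:ℕ) : ℝ) - 1 = n := by push_cast; ring
  rw [h2]
  congr 1
  rw [← mul_assoc]
  congr 1
  nth_rewrite 2 [← Real.sq_sqrt hK.le]
  have := Real.sqrt_pos.2 hK
  field_simp

lemma tst_law (n : ℕ) (hn : 1 ≤ n) (E : Set ℝ) (hE : MeasurableSet E) :
    stdGaussian (EuclideanSpace ℝ (Fin (n + 1))) {x | tst (n + 1) x ∈ E} = studentTMeasure n E := by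
  obtain ⟨f, hf⟩ := tst_repr n
  have hgm : Measurable (fun w : EuclideanSpace ℝ (Fin (n + 1)) => w 0 / √((n : ℝ)⁻¹ * ∑ i : Fin n, w i.succ ^ 2)) := by
    fun_prop
  have h1 : {x | tst (n + 1) x ∈ E} = f ⁻¹' {w | w 0 / √((n : ℝ)⁻¹ * ∑ i : Fin n, w i.succ ^ 2) ∈ E} := by
    ext x; simp [hf]
  have hgE : MeasurableSet {w : EuclideanSpace ℝ (Fin (n + 1)) | w 0 / √((n : ℝ)⁻¹ * ∑ i : Fin n, w i.succ ^ 2) ∈ E} := hgm hE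
  rw [h1, ← Measure.map_apply f.continuous.measurable hgE, stdGaussian_map, ← map_pi_eq_stdGaussian,
    Measure.map_apply (by fun_prop) hgE]
  have hmp := measurePreserving_piFinSuccAbove (fun _ : Fin (n + 1) => gaussianReal 0 1) 0
  have hmp2 : MeasurePreserving (WithLp.toLp 2 : (Fin n → ℝ) → EuclideanSpace ℝ (Fin n))
      (Measure.pi (fun _ => gaussianReal 0 1)) (stdGaussian _) := ⟨by fun_prop, map_pi_eq_stdGaussian⟩
  have hmp3 := ((MeasurePreserving.id (gaussianReal 0 1)).prod hmp2).comp hmp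
  rw [← student_prod n hn E hE]
  have hm : MeasurableSet {p : ℝ × EuclideanSpace ℝ (Fin n) | p.1 / (‖p.2‖ / √n) ∈ E} :=
    (by fun_prop : Measurable (fun p : ℝ × EuclideanSpace ℝ (Fin n) => p.1 / (‖p.2‖ / √n))) hE
  rw [← hmp3.measure_preimage hm.nullMeasurableSet]
  congr 1
  ext w
  simp [EuclideanSpace.norm_eq, MeasurableEquiv.piFinSuccAbove, Fin.insertNthEquiv]
  rw [mul_comm, ← div_eq_mul_inv]
  rfl
end partD
section partF
noncomputable def gij (γ : ℕ → ℝ) (s t : ℕ) : ℝ := γ ((t - s) + (s - t))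

lemma gij_comm (γ : ℕ → ℝ) (s t : ℕ) : gij γ s t = gij γ t s := by
  unfold gij; rw [add_comm]

lemma abs_gamma_summable (γ : ℕ → ℝ) (hsum : Summable (fun h : ℕ => (h : ℝ) ^ 2 * |γ h|)) :
    Summable (fun h => |γ h|) := by
  rw [← summable_nat_add_iff 1]
  refine Summable.of_nonneg_of_le (fun _ => abs_nonneg _) (fun h => ?_) ((summable_nat_add_iff 1).2 hsum)
  have : (1:ℝ) ≤ ((h + 1 : ℕ) : ℝ) ^ 2 := by
    push_cast; nlinarith [Nat.cast_nonneg (α := ℝ) h]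
  nlinarith [abs_nonneg (γ (h + 1))]

lemma tail_bound (γ : ℕ → ℝ) (hsum : Summable (fun h : ℕ => (h : ℝ) ^ 2 * |γ h|)) (m e : ℕ) :
    ∑' h, |γ (h + (e + (m + 1)))| ≤ (∑' h : ℕ, (h : ℝ) ^ 2 * |γ h|) * (1 / ((m + 1 : ℕ) : ℝ) ^ 2) := by
  have hm : (0:ℝ) < ((m + 1 : ℕ) : ℝ) ^ 2 := by positivity
  rw [mul_one_div, le_div_iff₀ hm, ← tsum_mul_right]
  have h1 := hsum.sum_add_tsum_nat_add (e + (m + 1))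
  rw [← h1]
  have h0 : 0 ≤ ∑ i ∈ range (e + (m + 1)), (i : ℝ) ^ 2 * |γ i| := sum_nonneg fun i _ => by positivity
  refine le_add_of_nonneg_of_le h0 ?_
  refine Summable.tsum_le_tsum (fun h => ?_)
    (((summable_nat_add_iff _).2 (abs_gamma_summable γ hsum)).mul_right _) ((summable_nat_add_iff _).2 hsum)
  rw [mul_comm]
  refine mul_le_mul_of_nonneg_right ?_ (abs_nonneg _)
  have : ((m + 1 : ℕ) : ℝ) ≤ ((h + (e + (m + 1)) : ℕ) : ℝ) := by
    exact_mod_cast (by omega : m + 1 ≤ h + (e + (m + 1)))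
  gcongr

lemma cov_bound (γ : ℕ → ℝ) (hsum : Summable (fun h : ℕ => (h : ℝ) ^ 2 * |γ h|)) :
    ∃ R : ℝ, 0 ≤ R ∧ ∀ G : ℕ, 1 ≤ G → ∀ j k : ℕ,
      |(∑ p ∈ range G, ∑ τ ∈ range G, gij γ (j * G + 1 + p) (k * G + 1 + τ))
        - (if j = k then G * (γ 0 + 2 * ∑' h : ℕ, γ (h + 1)) else 0)| ≤ R := by
  obtain ⟨M2, hM2⟩ : ∃ M2, M2 = ∑' h : ℕ, (h : ℝ) ^ 2 * |γ h| := ⟨_, rfl⟩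
  have hM0 : 0 ≤ M2 := hM2 ▸ tsum_nonneg fun h => by positivity
  obtain ⟨ρ, hρ⟩ : ∃ ρ : ℕ → ℝ, ρ = fun m => M2 * (1 / ((m + 1 : ℕ) : ℝ) ^ 2) := ⟨_, rfl⟩
  have hρ0 : ∀ m, 0 ≤ ρ m := fun m => by rw [hρ]; positivity
  have htb : ∀ m e, ∑' h, |γ (h + (e + (m + 1)))| ≤ ρ m := by
    intro m e; rw [hρ, hM2]; exact tail_bound γ hsum m e
  have hρs : Summable ρ := by
    rw [hρ]
    refine Summable.mul_left _ ?_
    exact (summable_nat_add_iff 1).2 (Real.summable_one_div_nat_pow.2 (by norm_num : 1 < 2))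
  have hs1 : ∀ G, ∑ p ∈ range G, ρ p ≤ ∑' m, ρ m := fun G => hρs.sum_le_tsum _ (fun m _ => hρ0 m)
  have hs2 : ∀ G, ∑ p ∈ range G, ρ (G - 1 - p) ≤ ∑' m, ρ m := fun G => by
    rw [sum_range_reflect]; exact hs1 G
  have hga := abs_gamma_summable γ hsum
  have hg1 : Summable (fun h => γ (h + 1)) := (summable_nat_add_iff 1).2 hga.of_abs
  have htail : ∀ p, |∑ h ∈ range p, γ (h + 1) - ∑' h, γ (h + 1)| ≤ ρ p := by
    intro p
    have h := hg1.sum_add_tsum_nat_add p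
    rw [← h]
    have h2 : ∀ a b : ℝ, |a - (a + b)| = |b| := by intro a b; rw [← abs_neg]; congr 1; ring
    rw [h2]
    have h3 := htb p 0
    refine le_trans ?_ h3
    have h4 : Summable fun i => |γ (i + (0 + (p + 1)))| :=
      (summable_nat_add_iff (f := fun h => |γ h|) (0 + (p + 1))).2 hga
    have h5 := norm_tsum_le_tsum_norm (f := fun i => γ (i + (0 + (p + 1)))) h4
    simp only [zero_add, Real.norm_eq_abs] at h5 ⊢
    exact h5
  have hoff : ∀ G : ℕ, 1 ≤ G → ∀ j k : ℕ, j < k →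
      |∑ p ∈ range G, ∑ τ ∈ range G, gij γ (j * G + 1 + p) (k * G + 1 + τ)| ≤ ∑' m, ρ m := by
    intro G hG j k hjk
    refine (abs_sum_le_sum_abs _ _).trans (le_trans ?_ (hs2 G))
    refine sum_le_sum fun p hp => ?_
    have hp' := mem_range.1 hp
    refine (abs_sum_le_sum_abs _ _).trans ?_
    refine le_trans ?_ (htb (G - 1 - p) ((k - j - 1) * G))
    have e : ∀ τ ∈ range G, |gij γ (j * G + 1 + p) (k * G + 1 + τ)| =
        |γ (τ + ((k - j - 1) * G + (G - 1 - p + 1)))| := by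
      intro τ _
      obtain ⟨d, rfl⟩ := Nat.exists_eq_add_of_lt hjk
      have h1 : j + d + 1 - j - 1 = d := by omega
      have h2 : (j + d + 1) * G = j * G + d * G + G := by ring
      rw [gij, h1, h2]
      congr 2
      omega
    rw [sum_congr rfl e]
    exact Summable.sum_le_tsum (f := fun τ => |γ (τ + ((k - j - 1) * G + (G - 1 - p + 1)))|) _ (fun _ _ => abs_nonneg _)
      ((summable_nat_add_iff (f := fun h => |γ h|) ((k - j - 1) * G + (G - 1 - p + 1))).2 hga)
  have hR : 0 ≤ ∑' m, ρ m := tsum_nonneg hρ0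
  refine ⟨2 * ∑' m, ρ m, by positivity, fun G hG j k => ?_⟩
  rcases lt_trichotomy j k with h | h | h
  · rw [if_neg h.ne, sub_zero]
    linarith [hoff G hG j k h]
  · subst h
    rw [if_pos rfl]
    have e : (G:ℝ) * (γ 0 + 2 * ∑' h : ℕ, γ (h + 1)) = ∑ p ∈ range G, (γ 0 + 2 * ∑' h : ℕ, γ (h + 1)) := by
      rw [sum_const, card_range, nsmul_eq_mul]
    rw [e, ← sum_sub_distrib]
    refine (abs_sum_le_sum_abs _ _).trans (le_trans (b := ∑ p ∈ range G, (ρ p + ρ (G - 1 - p))) ?_ (by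
      rw [sum_add_distrib]; linarith [hs1 G, hs2 G]))
    refine sum_le_sum fun p hp => ?_
    obtain ⟨d, rfl⟩ := Nat.exists_eq_add_of_lt (mem_range.1 hp)
    have h1 : ∑ τ ∈ range (p + d + 1), gij γ (j * (p + d + 1) + 1 + p) (j * (p + d + 1) + 1 + τ)
        = ∑ h ∈ range p, γ (h + 1) + γ 0 + ∑ h ∈ range d, γ (h + 1) := by
      rw [show p + d + 1 = (p + 1) + d by ring, sum_range_add, sum_range_succ]
      congr 1
      · congr 1
        · rw [← sum_range_reflect]
          refine sum_congr rfl fun τ hτ => ?_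
          have := mem_range.1 hτ
          rw [gij]; congr 1; omega
        · rw [gij]; congr 1; omega
      · refine sum_congr rfl fun τ hτ => ?_
        rw [gij]; congr 1; omega
    rw [h1, show p + d + 1 - 1 - p = d by omega]
    have a1 := htail p
    have a2 := htail d
    rw [abs_le] at a1 a2 ⊢
    constructor <;> linarith [a1.1, a1.2, a2.1, a2.2]
  · rw [if_neg h.ne', sub_zero, sum_comm]
    simp_rw [gij_comm γ (j * G + 1 + _)]
    linarith [hoff G hG k j h]
end partF
section partH
open Matrix MatrixOrder in
lemma law_exists {Ω : Type*} [MeasurableSpace Ω] (P : Measure Ω) [IsProbabilityMeasure P] (K : ℕ)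
    (X : Ω → EuclideanSpace ℝ (Fin K)) (hX : Measurable X) (S : Matrix (Fin K) (Fin K) ℝ)
    (hsym : ∀ i j, S i j = S j i)
    (hG : ∀ a : EuclideanSpace ℝ (Fin K), ∃ v : ℝ≥0, P.map (fun ω => inner ℝ (X ω) a) = gaussianReal 0 v)
    (hv : ∀ a : EuclideanSpace ℝ (Fin K), ∫ ω, (inner ℝ (X ω) a) ^ 2 ∂P = ∑ i, ∑ j, a i * a j * S i j) :
    ∃ L : EuclideanSpace ℝ (Fin K) →ₗ[ℝ] EuclideanSpace ℝ (Fin K),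
      P.map X = (stdGaussian _).map L ∧ ∀ a, ‖L a‖ ^ 2 = ∑ i, ∑ j, a i * a j * S i j := by
  have hq : ∀ a : Fin K → ℝ, a ⬝ᵥ S *ᵥ a = ∑ i, ∑ j, a i * a j * S i j := by
    intro a
    simp only [dotProduct, mulVec, mul_sum]
    refine sum_congr rfl fun i _ => sum_congr rfl fun j _ => by ring
  have hS : S.PosSemidef := by
    refine PosSemidef.of_dotProduct_mulVec_nonneg ?_ fun x => ?_
    · ext i j; simp [hsym i j]
    · rw [star_trivial, hq, ← hv (WithLp.toLp 2 x)]
      exact integral_nonneg fun ω => sq_nonneg _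
  refine ⟨(toEuclideanCLM (𝕜 := ℝ) (CFC.sqrt S) : EuclideanSpace ℝ (Fin K) →L[ℝ] EuclideanSpace ℝ (Fin K)), ?_, fun a => ?_⟩
  · have h1 : multivariateGaussian 0 S = (stdGaussian (EuclideanSpace ℝ (Fin K))).map
      (toEuclideanCLM (𝕜 := ℝ) (CFC.sqrt S)) := by
      unfold multivariateGaussian; simp only [zero_add]
    have h2 : P.map X = multivariateGaussian 0 S := by
      have : IsProbabilityMeasure (P.map X) := Measure.isProbabilityMeasure_map hX.aemeasurable
      apply Measure.ext_of_charFun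
      ext a
      rw [charFun_multivariateGaussian hS, charFun_apply, integral_map hX.aemeasurable (by fun_prop)]
      obtain ⟨v, hva⟩ := hG a
      have hm : Measurable (fun ω => inner ℝ (X ω) a) := by fun_prop
      have h3 := charFun_gaussianReal (μ := 0) (v := v) 1
      rw [← hva, charFun_apply, integral_map hm.aemeasurable (by fun_prop)] at h3
      have h4 : ∫ ω, (inner ℝ (X ω) a) ^ 2 ∂P = v := by
        have := variance_fun_id_gaussianReal (μ := 0) (v := v)
        rw [variance_eq_integral (by fun_prop)] at this
        simp only [integral_id_gaussianReal, sub_zero] at this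
        rw [← this, ← hva, integral_map hm.aemeasurable (by fun_prop)]
      rw [hq, ← hv, h4]
      simpa using h3
    rw [h2, h1]; rfl
  · rw [← hq, ← inner_toEuclideanCLM, ← real_inner_self_eq_norm_sq]
    nth_rewrite 3 [← CFC.sqrt_mul_sqrt_self S hS.nonneg]
    rw [map_mul, ContinuousLinearMap.mul_def, ContinuousLinearMap.comp_apply]
    have hsa : IsSelfAdjoint (toEuclideanCLM (𝕜 := ℝ) (CFC.sqrt S)) := (CFC.sqrt_nonneg S).isSelfAdjoint.map _
    rw [← ContinuousLinearMap.adjoint_inner_left, hsa.adjoint_eq]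
    rfl

lemma pow_bound (n : ℕ) (x : ℝ) (h0 : 0 ≤ x) (h2 : x ≤ 2) : (1 + x) ^ n ≤ 1 + 3 ^ n * x := by
  induction n with
  | zero => simp; exact h0
  | succ n ih =>
    have : (1 + x) ^ n ≤ 3 ^ n := pow_le_pow_left₀ (by linarith) (by linarith) n
    rw [pow_succ, pow_succ]
    have h := mul_le_mul_of_nonneg_right this h0
    have h3 : 0 ≤ (3:ℝ) ^ n * x := by positivity
    nlinarith

lemma compare {Ω : Type*} [MeasurableSpace Ω] (P : Measure Ω) [IsProbabilityMeasure P] (K : ℕ)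
    (X : Ω → EuclideanSpace ℝ (Fin K)) (hX : Measurable X)
    (L : EuclideanSpace ℝ (Fin K) →ₗ[ℝ] EuclideanSpace ℝ (Fin K))
    (hL : P.map X = (stdGaussian _).map L) (s ε : ℝ) (hs : 0 < s) (hε0 : 0 ≤ ε) (hε : ε ≤ 1 / 2)
    (hLq : ∀ a, |‖L a‖ ^ 2 - s * ‖a‖ ^ 2| ≤ s * ε * ‖a‖ ^ 2)
    (E : Set (EuclideanSpace ℝ (Fin K))) (hE : MeasurableSet E)
    (hsc : ∀ c : ℝ, 0 < c → ∀ x, c • x ∈ E ↔ x ∈ E) :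
    |(P (X ⁻¹' E)).toReal - (stdGaussian (EuclideanSpace ℝ (Fin K)) E).toReal| ≤ 3 ^ K * (4 * ε) := by
  have hm : 0 < s * (1 - ε) := by apply mul_pos hs; linarith
  have hM : 0 < s * (1 + ε) := by positivity
  have key : ∀ F : Set (EuclideanSpace ℝ (Fin K)), MeasurableSet F → (∀ c : ℝ, 0 < c → ∀ x, c • x ∈ F ↔ x ∈ F) →
      (P (X ⁻¹' F)).toReal ≤ (1 + 3 ^ K * (4 * ε)) * (stdGaussian (EuclideanSpace ℝ (Fin K)) F).toReal := by
    intro F hF hFs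
    have h := gauss_dom L _ _ hm hM (fun y => by linarith [(abs_le.1 (hLq y)).1])
      (fun y => by linarith [(abs_le.1 (hLq y)).2]) F hF hFs
    rw [← hL, Measure.map_apply hX hF, finrank_euclideanSpace, Fintype.card_fin] at h
    have h' := ENNReal.toReal_mono (ENNReal.mul_ne_top ENNReal.ofReal_ne_top (measure_ne_top _ _)) h
    rw [ENNReal.toReal_mul, ENNReal.toReal_ofReal (by positivity)] at h'
    refine h'.trans (mul_le_mul_of_nonneg_right ?_ ENNReal.toReal_nonneg)
    refine le_trans ?_ (pow_bound K (4 * ε) (by linarith) (by linarith))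
    refine pow_le_pow_left₀ (by positivity) ?_ K
    rw [← Real.sqrt_div hM.le, mul_div_mul_left _ _ hs.ne']
    have h1 : (1 + ε) / (1 - ε) ≤ 1 + 4 * ε := by
      rw [div_le_iff₀ (by linarith)]; nlinarith
    calc √((1 + ε) / (1 - ε)) ≤ √((1 + 4 * ε) ^ 2) := by
          apply Real.sqrt_le_sqrt; nlinarith
      _ = 1 + 4 * ε := Real.sqrt_sq (by linarith)
  have k1 := key E hE hsc
  have k2 := key Eᶜ hE.compl (fun c hc x => not_congr (hsc c hc x))
  rw [Set.preimage_compl, prob_compl_eq_one_sub (hX hE), prob_compl_eq_one_sub hE,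
    ENNReal.toReal_sub_of_le prob_le_one ENNReal.one_ne_top,
    ENNReal.toReal_sub_of_le prob_le_one ENNReal.one_ne_top] at k2
  have p1 : (stdGaussian (EuclideanSpace ℝ (Fin K)) E).toReal ≤ 1 := by
    have := ENNReal.toReal_mono ENNReal.one_ne_top (prob_le_one (μ := stdGaussian (EuclideanSpace ℝ (Fin K))) (s := E))
    simpa using this
  have p0 : 0 ≤ (stdGaussian (EuclideanSpace ℝ (Fin K)) E).toReal := ENNReal.toReal_nonneg
  rw [ENNReal.toReal_one] at k2
  have hc : (0:ℝ) ≤ 3 ^ K * (4 * ε) := by positivity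
  rw [abs_le]
  constructor <;> nlinarith
end partH
section partI
lemma blockMean_eq {Ω : Type*} (u : ℕ → Ω → ℝ) (G k : ℕ) (ω : Ω) :
    blockMean u G k ω = (G:ℝ)⁻¹ * ∑ p ∈ range G, u (k * G + 1 + p) ω := by
  unfold blockMean
  congr 1
  rw [show Finset.Ioc (k * G) ((k + 1) * G) = Finset.Ico (k * G + 1) (k * G + 1 + G) by
    ext x; simp only [mem_Ioc, mem_Ico]; rw [add_mul]; omega]
  rw [sum_Ico_eq_sum_range]
  simp

lemma lin_gauss {Ω : Type*} [MeasurableSpace Ω] (P : Measure Ω) (K : ℕ) (u : ℕ → Ω → ℝ)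
    (hGauss : ∀ (s : Finset ℕ) (a : ℕ → ℝ), ∃ v : ℝ≥0,
      Measure.map (fun ω => ∑ t ∈ s, a t * u t ω) P = gaussianReal 0 v) (G : ℕ) (a : Fin K → ℝ) :
    ∃ v : ℝ≥0, P.map (fun ω => ∑ k : Fin K, a k * blockMean u G k ω) = gaussianReal 0 v := by
  obtain ⟨v, hv⟩ := hGauss (range (K * G + 1)) (fun t => ∑ k : Fin K, a k * (G:ℝ)⁻¹ * if t ∈ Finset.Ioc (k * G) ((k + 1) * G) then 1 else 0)
  refine ⟨v, ?_⟩
  rw [← hv]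
  congr 1
  ext ω
  simp_rw [sum_mul]
  rw [sum_comm]
  refine sum_congr rfl fun k _ => ?_
  simp_rw [blockMean, mul_assoc, ← mul_sum]
  congr 2
  simp only [ite_mul, one_mul, zero_mul]
  rw [← sum_filter]
  refine sum_congr ?_ fun _ _ => rfl
  ext t
  simp only [mem_filter, mem_range, mem_Ioc]
  constructor
  · rintro ⟨h1, h2⟩
    refine ⟨?_, h1, h2⟩
    have : ((k:ℕ) + 1) * G ≤ K * G := Nat.mul_le_mul_right _ k.2
    omega
  · exact fun h => h.2

lemma block_cov {Ω : Type*} [MeasurableSpace Ω] (P : Measure Ω) [IsProbabilityMeasure P] (u : ℕ → Ω → ℝ) (γ : ℕ → ℝ)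
    (hu : ∀ t, MemLp (u t) 2 P)
    (hcov : ∀ t1 t2, t1 ≤ t2 → (∫ ω, u t1 ω * u t2 ω ∂P) = γ (t2 - t1)) (G j k : ℕ) :
    ∫ ω, blockMean u G j ω * blockMean u G k ω ∂P =
      ((G:ℝ)⁻¹) ^ 2 * ∑ p ∈ range G, ∑ τ ∈ range G, gij γ (j * G + 1 + p) (k * G + 1 + τ) := by
  have hc : ∀ s t, ∫ ω, u s ω * u t ω ∂P = gij γ s t := by
    intro s t
    rcases le_total s t with h | h
    · rw [hcov s t h, gij]; congr 1; omega
    · simp_rw [mul_comm (u s _)]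
      rw [hcov t s h, gij]; congr 1; omega
  have hi : ∀ s t, Integrable (fun ω => u s ω * u t ω) P := fun s t => (hu s).integrable_mul (hu t)
  have e : ∀ ω, blockMean u G j ω * blockMean u G k ω =
      ((G:ℝ)⁻¹) ^ 2 * ∑ p ∈ range G, ∑ τ ∈ range G, u (j * G + 1 + p) ω * u (k * G + 1 + τ) ω := by
    intro ω
    rw [blockMean_eq, blockMean_eq, ← sum_mul_sum]; ring
  simp_rw [e]
  rw [integral_const_mul, integral_finsetSum _ (fun p _ => integrable_finsetSum _ fun τ _ => hi _ _)]
  congr 1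
  refine sum_congr rfl fun p _ => ?_
  rw [integral_finsetSum _ (fun τ _ => hi _ _)]
  exact sum_congr rfl fun τ _ => hc _ _

lemma quad_cov {Ω : Type*} [MeasurableSpace Ω] (P : Measure Ω) [IsProbabilityMeasure P] (K : ℕ)
    (Y : Fin K → Ω → ℝ) (hY : ∀ k, MemLp (Y k) 2 P) (a : Fin K → ℝ) :
    ∫ ω, (∑ k, a k * Y k ω) ^ 2 ∂P = ∑ i, ∑ j, a i * a j * ∫ ω, Y i ω * Y j ω ∂P := by
  have hi : ∀ s t, Integrable (fun ω => a s * a t * (Y s ω * Y t ω)) P :=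
    fun s t => ((hY s).integrable_mul (hY t)).const_mul _
  have e : ∀ ω, (∑ k, a k * Y k ω) ^ 2 = ∑ i, ∑ j, a i * a j * (Y i ω * Y j ω) := by
    intro ω
    rw [sq, sum_mul_sum]
    exact sum_congr rfl fun i _ => sum_congr rfl fun j _ => by ring
  simp_rw [e]
  rw [integral_finsetSum _ (fun p _ => integrable_finsetSum _ fun τ _ => hi _ _)]
  refine sum_congr rfl fun p _ => ?_
  rw [integral_finsetSum _ (fun τ _ => hi _ _)]
  exact sum_congr rfl fun τ _ => integral_const_mul _ _

lemma quad_bound (K : ℕ) (B : Fin K → Fin K → ℝ) (s c : ℝ) (hc : 0 ≤ c)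
    (hB : ∀ i j, |B i j - if i = j then s else 0| ≤ c) (a : EuclideanSpace ℝ (Fin K)) :
    |(∑ i, ∑ j, a i * a j * B i j) - s * ‖a‖ ^ 2| ≤ c * K * ‖a‖ ^ 2 := by
  rw [EuclideanSpace.real_norm_sq_eq]
  have e : (∑ i, ∑ j, a i * a j * B i j) - s * ∑ i, a i ^ 2 =
      ∑ i, ∑ j, a i * a j * (B i j - if i = j then s else 0) := by
    simp_rw [mul_sub, sum_sub_distrib]
    congr 1
    rw [mul_sum]
    refine sum_congr rfl fun i _ => ?_
    simp; ring
  rw [e]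
  calc _ ≤ ∑ i, ∑ j, |a i| * |a j| * c := by
        refine (abs_sum_le_sum_abs _ _).trans (sum_le_sum fun i _ => ?_)
        refine (abs_sum_le_sum_abs _ _).trans (sum_le_sum fun j _ => ?_)
        rw [abs_mul, abs_mul]
        exact mul_le_mul_of_nonneg_left (hB i j) (by positivity)
    _ = c * (∑ i, |a i|) ^ 2 := by
        rw [sq, sum_mul_sum, mul_sum]
        refine sum_congr rfl fun i _ => ?_
        rw [mul_sum]
        exact sum_congr rfl fun j _ => by ring
    _ ≤ c * (K * ∑ i, a i ^ 2) := by
        refine mul_le_mul_of_nonneg_left ?_ hc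
        have := sq_sum_le_card_mul_sum_sq (s := (univ : Finset (Fin K))) (f := fun i => |a i|)
        simpa using this
    _ = _ := by ring
end partI
/-- higher-order accuracy of the self-normalized t-test in the
Gaussian location model: under `H₀ : β = 0`, the rejection probability differs
from `α` by `O(T⁻¹)` where `T = KG`. -/
theorem gaussian_location_higher_order
    {Ω : Type*} [MeasureSpace Ω] [IsProbabilityMeasure (ℙ : Measure Ω)]
    (K : ℕ) (hK : 2 ≤ K)
    (u : ℕ → Ω → ℝ) (γ : ℕ → ℝ)
    (hmeas : ∀ t, Measurable (u t))
    (hGauss : ∀ (s : Finset ℕ) (a : ℕ → ℝ), ∃ v : ℝ≥0,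
      Measure.map (fun ω => ∑ t ∈ s, a t * u t ω) ℙ = gaussianReal 0 v)
    (hcov : ∀ t1 t2, t1 ≤ t2 → (∫ ω, u t1 ω * u t2 ω ∂ℙ) = γ (t2 - t1))
    (hsum : Summable (fun h : ℕ => (h : ℝ) ^ 2 * |γ h|))
    (hlrv : 0 < γ 0 + 2 * ∑' h : ℕ, γ (h + 1))
    (α q : ℝ) (hα : 0 < α) (hα1 : α < 1)
    (hq : studentTMeasure ((K : ℝ) - 1) {x : ℝ | q < |x|} = ENNReal.ofReal α) :
    ∃ C : ℝ, ∀ G : ℕ, 1 ≤ G →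
      |(ℙ {ω | q < |selfNormT K (fun k => blockMean u G k ω)|}).toReal - α|
        ≤ C / ((K * G : ℕ) : ℝ) := by
  obtain ⟨n, rfl⟩ : ∃ n, K = n + 1 := ⟨K - 1, by omega⟩
  have hn : 1 ≤ n := by omega
  obtain ⟨R, hR0, hR⟩ := cov_bound γ hsum
  obtain ⟨σ2, hσ⟩ : ∃ σ2, σ2 = γ 0 + 2 * ∑' h : ℕ, γ (h + 1) := ⟨_, rfl⟩
  rw [← hσ] at hlrv
  have hu : ∀ t, MemLp (u t) 2 ℙ := by
    intro t
    obtain ⟨v, hv⟩ := hGauss {t} (fun _ => 1)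
    simp only [sum_singleton, one_mul] at hv
    have h := memLp_id_gaussianReal' (μ := 0) (v := v) 2 (by simp)
    rw [← hv, memLp_map_measure_iff (by fun_prop) (hmeas t).aemeasurable] at h
    exact h
  have hbm : ∀ G k, Measurable (fun ω => blockMean u G k ω) := by
    intro G k; unfold blockMean; fun_prop
  have hbL : ∀ G k, MemLp (fun ω => blockMean u G k ω) 2 ℙ := by
    intro G k; unfold blockMean
    exact (memLp_finsetSum _ fun t _ => hu t).const_mul _
  have hEm : MeasurableSet {x : ℝ | q < |x|} := measurableSet_lt measurable_const (by fun_prop)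
  -- the limit law
  have hlim : stdGaussian (EuclideanSpace ℝ (Fin (n + 1))) {x | tst (n + 1) x ∈ {x : ℝ | q < |x|}}
      = ENNReal.ofReal α := by
    rw [tst_law n hn _ hEm, ← hq]; congr 2; push_cast; ring
  have hset : MeasurableSet {x | tst (n + 1) x ∈ {x : ℝ | q < |x|}} := tst_measurable (n + 1) hEm
  have hsc : ∀ c : ℝ, 0 < c → ∀ x, c • x ∈ {x | tst (n + 1) x ∈ {x : ℝ | q < |x|}} ↔
      x ∈ {x | tst (n + 1) x ∈ {x : ℝ | q < |x|}} := by
    intro c hc x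
    show q < |tst (n + 1) (c • x)| ↔ q < |tst (n + 1) x|
    rw [tst_scale _ c hc]
  obtain ⟨e0, he0⟩ : ∃ e0, e0 = R * ((n + 1 : ℕ) : ℝ) / σ2 := ⟨_, rfl⟩
  have he00 : 0 ≤ e0 := by rw [he0]; positivity
  refine ⟨((n + 1 : ℕ) : ℝ) * (3 ^ (n + 1) * 4 * e0 + 2 * e0), fun G hG => ?_⟩
  have hG' : (0:ℝ) < G := by exact_mod_cast hG
  have hKp : (0:ℝ) < ((n + 1 : ℕ) : ℝ) := by positivity
  have hrhs : ((n + 1 : ℕ) : ℝ) * (3 ^ (n + 1) * 4 * e0 + 2 * e0) / (((n + 1) * G : ℕ) : ℝ) =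
      3 ^ (n + 1) * (4 * (e0 / G)) + 2 * (e0 / G) := by
    rw [Nat.cast_mul]; field_simp
  rw [hrhs]
  obtain ⟨ε, hεdef⟩ : ∃ ε, ε = e0 / (G:ℝ) := ⟨_, rfl⟩
  rw [← hεdef]
  have hε0 : 0 ≤ ε := by rw [hεdef]; positivity
  have h3 : (0:ℝ) ≤ 3 ^ (n + 1) * (4 * ε) := by positivity
  rcases le_or_gt ε (1 / 2) with hε | hε
  · -- main case
    let X : Ω → EuclideanSpace ℝ (Fin (n + 1)) := fun ω => WithLp.toLp 2 (fun k => blockMean u G k ω)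
    have hX : Measurable X := by
      have : Measurable (fun ω => (fun k : Fin (n + 1) => blockMean u G k ω)) :=
        measurable_pi_lambda _ fun k => hbm G k
      exact (MeasurableEquiv.toLp 2 (Fin (n + 1) → ℝ)).measurable.comp this
    have hev : {ω | q < |selfNormT (n + 1) (fun k => blockMean u G k ω)|} =
        X ⁻¹' {x | tst (n + 1) x ∈ {x : ℝ | q < |x|}} := by
      ext ω
      simp only [Set.mem_ofPred_eq, Set.mem_preimage, selfNormT, tst, X, Finset.sum_range]
    have hinner : ∀ a : EuclideanSpace ℝ (Fin (n + 1)), ∀ ω, inner ℝ (X ω) a = ∑ k : Fin (n + 1), a k * blockMean u G k ω := by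
      intro a ω
      simp [PiLp.inner_apply, X]
    let S : Matrix (Fin (n + 1)) (Fin (n + 1)) ℝ := fun i j => ∫ ω, blockMean u G i ω * blockMean u G j ω
    obtain ⟨L, hL, hLq⟩ := law_exists ℙ (n + 1) X hX S
      (fun i j => by simp only [S]; congr 1; ext ω; ring)
      (fun a => by simp_rw [hinner]; exact lin_gauss ℙ (n + 1) u hGauss G a)
      (fun a => by
        simp_rw [hinner]
        exact quad_cov ℙ (n + 1) (fun k ω => blockMean u G k ω) (fun k => hbL G k) a)
    have hSb : ∀ i j, |S i j - if i = j then σ2 / G else 0| ≤ R / G ^ 2 := by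
      intro i j
      have h := hR G hG i j
      rw [← hσ] at h
      simp only [S]
      rw [block_cov ℙ u γ hu hcov G i j]
      have e : ∀ B : ℝ, ((G:ℝ)⁻¹) ^ 2 * B - (if i = j then σ2 / G else 0) =
          ((G:ℝ)⁻¹) ^ 2 * (B - if (i:ℕ) = j then G * σ2 else 0) := by
        intro B
        simp only [Fin.ext_iff]
        split_ifs
        · field_simp
        · ring
      rw [e, abs_mul, abs_of_pos (by positivity), inv_pow, ← div_eq_inv_mul]
      gcongr
    have hmain := compare ℙ (n + 1) X hX L hL (σ2 / G) ε (by positivity) hε0 hε (fun a => by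
      rw [hLq]
      refine (quad_bound (n + 1) S (σ2 / G) (R / G ^ 2) (by positivity) hSb a).trans (le_of_eq ?_)
      rw [hεdef, he0]; field_simp) _ hset hsc
    rw [hlim, ENNReal.toReal_ofReal hα.le, ← hev] at hmain
    linarith
  · have p0 : 0 ≤ (ℙ {ω | q < |selfNormT (n + 1) (fun k => blockMean u G k ω)|}).toReal := ENNReal.toReal_nonneg
    have p1 : (ℙ {ω | q < |selfNormT (n + 1) (fun k => blockMean u G k ω)|}).toReal ≤ 1 := by
      have := ENNReal.toReal_mono ENNReal.one_ne_top (prob_le_one (μ := (ℙ : Measure Ω)) (s := {ω | q < |selfNormT (n + 1) (fun k => blockMean u G k ω)|}))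
      simpa using this
    rw [abs_le]
    constructor <;> linarith
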